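/- The unit vector basis (e_i) is a 1-unconditional and 1-subsymmetric Schauder basis of the Schlumprecht space S: for all finitely supported scalars (a_i), all signs ε_i ∈ {−1, 1}, and every strictly increasing map σ : ℕ → ℕ, one has ‖Σ ε_i a_i e_i‖ = ‖Σ a_i e_i‖ and ‖Σ a_i e_{σ(i)}‖ = ‖Σ a_i e_i‖, and the closed linear span of (e_i) is all of S. -/

import Mathlib

open Filter Topology

noncomputable section

/-- `f(t) = log₂(t+1)`. -/
def schF (t : ℝ) : ℝ := Real.logb 2 (t + 1)

/-- For a finitely supported scalar sequence `a`, the vector `Σᵢ aᵢ eᵢ`. -/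
def embed {S : Type*} [NormedAddCommGroup S] [NormedSpace ℝ S] (e : ℕ → S) (a : ℕ →₀ ℝ) : S :=
  a.sum fun i c => c • e i

/-- The restriction `Ex` of `x = Σ aᵢ eᵢ` to the coordinates in the finite set `E`. -/
def restr (a : ℕ →₀ ℝ) (E : Finset ℕ) : ℕ →₀ ℝ := a.filter (· ∈ E)

/-- `E₁ < E₂ < ⋯ < E_r` : a successive family of finite subsets of ℕ. -/
def Succ {r : ℕ} (E : Fin r → Finset ℕ) : Prop :=
  ∀ i j : Fin r, i < j → ∀ m ∈ E i, ∀ n ∈ E j, m < n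

/-- `S` is (a realization of) the Schlumprecht space with unit vector basis `e`:
a Banach space in which the span of `e` is dense and whose norm satisfies, on the
finitely supported vectors `Σ aᵢ eᵢ`, the implicit Schlumprecht equation. -/
structure IsSchlumprecht (S : Type*) [NormedAddCommGroup S] [NormedSpace ℝ S] (e : ℕ → S) :
    Prop where
  dense_span : Dense (Submodule.span ℝ (Set.range e) : Set S)
  norm_eq : ∀ a : ℕ →₀ ℝ,
    ‖embed e a‖ = max (⨆ i, |a i|)
      (sSup {c : ℝ | ∃ r : ℕ, 2 ≤ r ∧ ∃ E : Fin r → Finset ℕ, Succ E ∧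
        c = (schF r)⁻¹ * ∑ i, ‖embed e (restr a (E i))‖})

/-- `b` is a normalized block basis of the unit vector basis `e`. -/
def IsNormalizedBlockBasis {S : Type*} [NormedAddCommGroup S] [NormedSpace ℝ S] (e : ℕ → S)
    (b : ℕ → ℕ →₀ ℝ) : Prop :=
  (∀ k, b k ≠ 0) ∧ (∀ k, ∀ m ∈ (b k).support, ∀ n ∈ (b (k + 1)).support, m < n) ∧
  (∀ k, ‖embed e (b k)‖ = 1)

/-- The series `Σ g k` converges to `s` (convergence of partial sums). -/
def SeriesSum {S : Type*} [AddCommMonoid S] [TopologicalSpace S] (g : ℕ → S) (s : S) : Prop :=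
  Tendsto (fun m => ∑ k ∈ Finset.range m, g k) atTop (𝓝 s)

/-- `V` is isomorphic (linearly homeomorphic) to the S-sum `(Σₖ ⊕ X k)_S`,
where the S-sum consists of all `y : Π k, X k` such that `Σₖ ‖y k‖ e k` converges in `S`,
normed by `‖Σₖ ‖y k‖ e k‖`. -/
def IsoToSSum {S : Type*} [NormedAddCommGroup S] [NormedSpace ℝ S] (e : ℕ → S)
    (V : Type*) [NormedAddCommGroup V] [Module ℝ V]
    (X : ℕ → Type*) [∀ k, NormedAddCommGroup (X k)] [∀ k, Module ℝ (X k)] : Prop :=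
  ∃ (T : V →ₗ[ℝ] Π k, X k) (A B : ℝ), 0 < A ∧ 0 < B ∧
    (Set.range T = {y | ∃ s : S, SeriesSum (fun k => ‖y k‖ • e k) s}) ∧
    ∀ v : V, ∃ s : S, SeriesSum (fun k => ‖T v k‖ • e k) s ∧
      A * ‖v‖ ≤ ‖s‖ ∧ ‖s‖ ≤ B * ‖v‖

/-- Two finitely supported sequences are equimodular when an order isomorphism between their
supports matches the absolute values of their entries; the maps `σ` and `τ` realize this
isomorphism and its inverse. -/
def Equimodular (a b : ℕ →₀ ℝ) : Prop :=
  ∃ σ τ : ℕ → ℕ,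
    (∀ i ∈ a.support, σ i ∈ b.support ∧ τ (σ i) = i ∧ |b (σ i)| = |a i|) ∧
    (∀ j ∈ b.support, τ j ∈ a.support ∧ σ (τ j) = j) ∧
    ∀ i ∈ a.support, ∀ j ∈ a.support, i < j → σ i < σ j

theorem Equimodular.symm {a b : ℕ →₀ ℝ} (h : Equimodular a b) : Equimodular b a := by
  obtain ⟨σ, τ, hσ, hτ, hmono⟩ := h
  refine ⟨τ, σ, fun j hj => ⟨(hτ j hj).1, (hτ j hj).2, ?_⟩,
    fun i hi => ⟨(hσ i hi).1, (hσ i hi).2.1⟩, fun i hi j hj hij => ?_⟩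
  · have := (hσ _ (hτ j hj).1).2.2
    rw [(hτ j hj).2] at this
    exact this.symm
  · by_contra! hlt
    rcases hlt.lt_or_eq with hlt | heq
    · have := hmono _ (hτ j hj).1 _ (hτ i hi).1 hlt
      rw [(hτ j hj).2, (hτ i hi).2] at this
      omega
    · have : σ (τ j) = σ (τ i) := by rw [heq]
      rw [(hτ j hj).2, (hτ i hi).2] at this
      omega

theorem mem_support_restr {a : ℕ →₀ ℝ} {E : Finset ℕ} {i : ℕ} :
    i ∈ (restr a E).support ↔ i ∈ a.support ∧ i ∈ E := by
  simp [restr, and_comm]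

theorem restr_apply_of_mem {a : ℕ →₀ ℝ} {E : Finset ℕ} {i : ℕ} (hi : i ∈ E) :
    restr a E i = a i := by
  simp [restr, hi]

theorem restr_eq_self {a : ℕ →₀ ℝ} {E : Finset ℕ} (h : a.support ⊆ E) : restr a E = a :=
  Finsupp.filter_eq_self_iff _ _ |>.2 fun _ hi => h (Finsupp.mem_support_iff.2 hi)

theorem restr_eq_zero {a : ℕ →₀ ℝ} {E : Finset ℕ} (h : ∀ i ∈ a.support, i ∉ E) :
    restr a E = 0 :=
  Finsupp.filter_eq_zero_iff _ _ |>.2 fun i hiE => by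
    by_contra hi
    exact h i (Finsupp.mem_support_iff.2 hi) hiE

theorem Succ.eq_of_mem {r : ℕ} {E : Fin r → Finset ℕ} (hE : Succ E) {i j : Fin r} {m : ℕ}
    (hi : m ∈ E i) (hj : m ∈ E j) : i = j := by
  rcases lt_trichotomy i j with h | h | h
  · exact absurd (hE i j h m hi m hj) (lt_irrefl _)
  · exact h
  · exact absurd (hE j i h m hj m hi) (lt_irrefl _)

/-- A successive family of sets can be transported along an equimodular pair. -/
theorem Equimodular.exists_succ {a b : ℕ →₀ ℝ} (h : Equimodular a b) {r : ℕ}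
    {E : Fin r → Finset ℕ} (hE : Succ E) :
    ∃ E' : Fin r → Finset ℕ, Succ E' ∧
      ∀ k, Equimodular (restr a (E k)) (restr b (E' k)) := by
  obtain ⟨σ, τ, hσ, hτ, hmono⟩ := h
  refine ⟨fun k => (E k ∩ a.support).image σ, ?_, fun k => ⟨σ, τ, ?_, ?_, ?_⟩⟩
  · intro k l hkl m hm n hn
    simp only [Finset.mem_image, Finset.mem_inter] at hm hn
    obtain ⟨i, ⟨hiE, hia⟩, rfl⟩ := hm
    obtain ⟨j, ⟨hjE, hja⟩, rfl⟩ := hn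
    exact hmono i hia j hja (hE k l hkl i hiE j hjE)
  · intro i hi
    obtain ⟨hia, hiE⟩ := mem_support_restr.1 hi
    have hmem : σ i ∈ (E k ∩ a.support).image σ :=
      Finset.mem_image_of_mem σ (Finset.mem_inter.2 ⟨hiE, hia⟩)
    refine ⟨mem_support_restr.2 ⟨(hσ i hia).1, hmem⟩, (hσ i hia).2.1, ?_⟩
    rw [restr_apply_of_mem hmem, restr_apply_of_mem hiE]
    exact (hσ i hia).2.2
  · intro j hj
    obtain ⟨hjb, hjE⟩ := mem_support_restr.1 hj
    obtain ⟨i, hi, rfl⟩ := Finset.mem_image.1 hjE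
    obtain ⟨hiE, hia⟩ := Finset.mem_inter.1 hi
    rw [(hσ i hia).2.1]
    exact ⟨mem_support_restr.2 ⟨hia, hiE⟩, rfl⟩
  · intro i hi j hj
    exact hmono i (mem_support_restr.1 hi).1 j (mem_support_restr.1 hj).1

theorem one_lt_schF_two : 1 < schF 2 := by
  rw [schF, Real.lt_logb_iff_rpow_lt (by norm_num) (by norm_num)]
  norm_num

theorem schF_two_le {r : ℕ} (hr : 2 ≤ r) : schF 2 ≤ schF r := by
  have : (2 : ℝ) ≤ r := by exact_mod_cast hr
  exact Real.logb_le_logb_of_le (by norm_num) (by norm_num) (by linarith)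

theorem abs_le_iSup_abs (a : ℕ →₀ ℝ) (i : ℕ) : |a i| ≤ ⨆ j, |a j| := by
  refine le_ciSup (f := fun j => |a j|) ⟨∑ j ∈ a.support, |a j|, ?_⟩ i
  rintro _ ⟨j, rfl⟩
  by_cases hj : j ∈ a.support
  · exact Finset.single_le_sum (f := fun j => |a j|) (fun _ _ => abs_nonneg _) hj
  · simp only [Finsupp.notMem_support_iff.1 hj, abs_zero]
    exact Finset.sum_nonneg fun _ _ => abs_nonneg _

section Norm

variable {S : Type*} [NormedAddCommGroup S] [NormedSpace ℝ S] {e : ℕ → S}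

theorem embed_zero : embed e 0 = 0 := Finsupp.sum_zero_index

theorem norm_embed_restr_le (e : ℕ → S) (a : ℕ →₀ ℝ) (E : Finset ℕ) :
    ‖embed e (restr a E)‖ ≤ ∑ j ∈ a.support, if j ∈ E then ‖a j • e j‖ else 0 := by
  have hsupp : (restr a E).support = a.support.filter (· ∈ E) := by
    ext i
    rw [mem_support_restr, Finset.mem_filter]
  rw [← Finset.sum_filter, embed, Finsupp.sum, hsupp]
  refine (norm_sum_le _ _).trans (Finset.sum_le_sum fun j hj => ?_)
  rw [restr_apply_of_mem (Finset.mem_filter.1 hj).2]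

theorem sum_norm_embed_restr_le (e : ℕ → S) (a : ℕ →₀ ℝ) {r : ℕ} {E : Fin r → Finset ℕ}
    (hE : Succ E) :
    ∑ k, ‖embed e (restr a (E k))‖ ≤ ∑ j ∈ a.support, ‖a j • e j‖ := by
  refine (Finset.sum_le_sum fun k _ => norm_embed_restr_le e a (E k)).trans ?_
  rw [Finset.sum_comm]
  refine Finset.sum_le_sum fun j _ => ?_
  by_cases h : ∃ k, j ∈ E k
  · obtain ⟨k, hk⟩ := h
    rw [Finset.sum_eq_single k _ (by simp), if_pos hk]
    intro l _ hl
    exact if_neg fun hjl => hl (hE.eq_of_mem hjl hk)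
  · push Not at h
    rw [Finset.sum_eq_zero fun k _ => if_neg (h k)]
    exact norm_nonneg _

theorem IsSchlumprecht.inv_mul_sum_le (hS : IsSchlumprecht S e) (a : ℕ →₀ ℝ) {r : ℕ}
    (hr : 2 ≤ r) {E : Fin r → Finset ℕ} (hE : Succ E) :
    (schF r)⁻¹ * ∑ k, ‖embed e (restr a (E k))‖ ≤ ‖embed e a‖ := by
  rw [hS.norm_eq a]
  refine le_max_of_le_right (le_csSup ⟨∑ j ∈ a.support, ‖a j • e j‖, ?_⟩ ⟨r, hr, E, hE, rfl⟩)
  rintro _ ⟨s, hs, F, hF, rfl⟩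
  have hinv : (schF s)⁻¹ ≤ 1 := inv_le_one_of_one_le₀ (one_lt_schF_two.le.trans (schF_two_le hs))
  exact (mul_le_of_le_one_left (Finset.sum_nonneg fun _ _ => norm_nonneg _) hinv).trans
    (sum_norm_embed_restr_le e a hF)

theorem sum_norm_embed_restr_of_subset (e : ℕ → S) {a : ℕ →₀ ℝ} {r : ℕ} {E : Fin r → Finset ℕ}
    (hE : Succ E) {k : Fin r} (hk : a.support ⊆ E k) :
    ∑ l, ‖embed e (restr a (E l))‖ = ‖embed e a‖ := by
  rw [Finset.sum_eq_single k _ (by simp), restr_eq_self hk]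
  intro l _ hl
  rw [restr_eq_zero fun i hi hil => hl (hE.eq_of_mem hil (hk hi)), embed_zero, norm_zero]

theorem IsSchlumprecht.norm_embed_le_of_equimodular (hS : IsSchlumprecht S e) {a b : ℕ →₀ ℝ}
    (h : Equimodular a b) : ‖embed e a‖ ≤ ‖embed e b‖ := by
  induction hn : a.support.card using Nat.strong_induction_on generalizing a b with
  | _ n ih =>
  subst hn
  by_contra! hlt
  have hpos : 0 < ‖embed e a‖ := (norm_nonneg _).trans_lt hlt
  have hmax : max ‖embed e b‖ ((schF 2)⁻¹ * ‖embed e a‖) < ‖embed e a‖ :=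
    max_lt hlt (mul_lt_of_lt_one_left hpos (inv_lt_one_of_one_lt₀ one_lt_schF_two))
  have hnonneg : 0 ≤ max ‖embed e b‖ ((schF 2)⁻¹ * ‖embed e a‖) :=
    le_max_of_le_left (norm_nonneg _)
  refine hmax.not_ge ?_
  conv_lhs => rw [hS.norm_eq a]
  refine max_le (ciSup_le fun i => ?_) (Real.sSup_le ?_ hnonneg)
  · by_cases hi : i ∈ a.support
    · obtain ⟨σ, τ, hσ, -, -⟩ := h
      rw [← (hσ i hi).2.2]
      refine le_max_of_le_left ((abs_le_iSup_abs b (σ i)).trans ?_)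
      rw [hS.norm_eq b]
      exact le_max_left _ _
    · rwa [Finsupp.notMem_support_iff.1 hi, abs_zero]
  · rintro _ ⟨r, hr, E, hE, rfl⟩
    have hr0 : 0 < schF r := zero_lt_one.trans (one_lt_schF_two.trans_le (schF_two_le hr))
    by_cases hk : ∃ k, a.support ⊆ E k
    · obtain ⟨k, hk⟩ := hk
      rw [sum_norm_embed_restr_of_subset e hE hk]
      refine le_max_of_le_right (mul_le_mul_of_nonneg_right ?_ (norm_nonneg _))
      exact inv_anti₀ (zero_lt_one.trans one_lt_schF_two) (schF_two_le hr)
    · push Not at hk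
      obtain ⟨E', hE', hEE'⟩ := h.exists_succ hE
      refine le_max_of_le_left (le_trans ?_ (hS.inv_mul_sum_le b hr hE'))
      refine mul_le_mul_of_nonneg_left (Finset.sum_le_sum fun k _ => ?_) (inv_nonneg.2 hr0.le)
      refine ih _ (Finset.card_lt_card ⟨fun i hi => (mem_support_restr.1 hi).1, fun hsub => ?_⟩)
        (hEE' k) rfl
      exact hk k fun i hi => (mem_support_restr.1 (hsub hi)).2

theorem IsSchlumprecht.norm_embed_eq_of_equimodular (hS : IsSchlumprecht S e) {a b : ℕ →₀ ℝ}
    (h : Equimodular a b) : ‖embed e a‖ = ‖embed e b‖ :=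
  (hS.norm_embed_le_of_equimodular h).antisymm (hS.norm_embed_le_of_equimodular h.symm)

end Norm

/-- the unit vector basis `(e i)` is 1-unconditional and 1-subsymmetric in
the Schlumprecht space: changing signs of the coefficients or passing to a strictly
increasing re-indexing does not change the norm of `Σ aᵢ eᵢ`, and the closed linear span
of `(e i)` is all of `S`. -/
theorem basis_one_unconditional_one_subsymmetric {S : Type*} [NormedAddCommGroup S]
    [NormedSpace ℝ S] [CompleteSpace S] (e : ℕ → S) (hS : IsSchlumprecht S e) :
    (∀ (a : ℕ →₀ ℝ) (ε : ℕ → ℝ), (∀ i, ε i = 1 ∨ ε i = -1) →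
        ‖a.sum fun i c => (ε i * c) • e i‖ = ‖embed e a‖) ∧
      (∀ (a : ℕ →₀ ℝ) (σ : ℕ → ℕ), StrictMono σ →
        ‖a.sum fun i c => c • e (σ i)‖ = ‖embed e a‖) ∧
      Dense (Submodule.span ℝ (Set.range e) : Set S) := by
  refine ⟨fun a ε hε => ?_, fun a σ hσ => ?_, hS.dense_span⟩
  · have hε0 : ∀ i, ε i ≠ 0 := fun i => by rcases hε i with h | h <;> simp [h]
    have hεabs : ∀ i, |ε i| = 1 := fun i => by rcases hε i with h | h <;> simp [h]
    let b : ℕ →₀ ℝ := Finsupp.onFinset a.support (fun i => ε i * a i) fun i hi =>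
      Finsupp.mem_support_iff.2 (right_ne_zero_of_mul hi)
    have hb : ∀ i, b i = ε i * a i := fun _ => rfl
    have hsupp : b.support = a.support := by
      ext i
      simp [hb, hε0 i]
    have hsum : (a.sum fun i c => (ε i * c) • e i) = embed e b := by
      rw [embed, Finsupp.sum, Finsupp.sum, hsupp]
      rfl
    rw [hsum]
    refine hS.norm_embed_eq_of_equimodular ⟨id, id, fun i hi => ⟨hsupp ▸ hi, rfl, ?_⟩,
      fun i hi => ⟨hsupp ▸ hi, rfl⟩, fun _ _ _ _ hij => hij⟩
    rw [id, hb, abs_mul, hεabs, one_mul]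
  · have hsum : (a.sum fun i c => c • e (σ i)) =
        embed e (a.embDomain ⟨σ, hσ.injective⟩) := by
      rw [embed, Finsupp.sum_embDomain]
      rfl
    rw [hsum]
    refine (hS.norm_embed_eq_of_equimodular ⟨σ, Function.invFun σ, fun i hi => ⟨?_,
      Function.leftInverse_invFun hσ.injective i, ?_⟩, fun j hj => ?_,
      fun _ _ _ _ hij => hσ hij⟩).symm
    · rw [Finsupp.support_embDomain]
      exact Finset.mem_map_of_mem ⟨σ, hσ.injective⟩ hi
    · exact congrArg abs (Finsupp.embDomain_apply_self ⟨σ, hσ.injective⟩ a i)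
    · rw [Finsupp.support_embDomain] at hj
      obtain ⟨i, hi, rfl⟩ := Finset.mem_map.1 hj
      have hinv : Function.invFun σ (σ i) = i := Function.leftInverse_invFun hσ.injective i
      simp only [Function.Embedding.coeFn_mk, hinv]
      exact ⟨hi, trivial⟩
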